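/- arXiv:1411.6805 — 12 statements merged into one kernel-verified Lean document; each statement's English description precedes it below -/
import Mathlib

section
/- Let M ≥ 1 and p ≥ 2 be integers, and let (u_j)_{j≥0} be a sequence of real numbers satisfying u_{j+p} = u_j for all j ≥ 0. If Σ_{j=0}^{M} C(M,j)·(−1)^j·u_{i+j} ≥ 0 for every i = 0, 1, …, p−1, or if Σ_{j=0}^{M} C(M,j)·(−1)^j·u_{i+j} ≤ 0 for every i = 0, 1, …, p−1, then u_0 = u_1 = ⋯ = u_{p−1}. -/
open fwdDiff in
theorem circ_sum_eq (M : ℕ) (u : ℕ → ℝ) (i : ℕ) :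
    ∑ j ∈ Finset.range (M + 1), (M.choose j : ℝ) * (-1) ^ j * u (i + j)
      = (-1) ^ M * (fwdDiff 1)^[M] u i := by
  rw [fwdDiff_iter_eq_sum_shift, Finset.mul_sum]
  refine Finset.sum_congr rfl fun j hj => ?_
  have hj' : j ≤ M := by simpa [Nat.lt_succ_iff] using hj
  obtain ⟨k, rfl⟩ := Nat.exists_eq_add_of_le hj'
  have h1 : ((-1 : ℝ) ^ k) * (-1) ^ k = 1 := by
    rw [← mul_pow]; simp
  simp only [add_tsub_cancel_left, zsmul_eq_mul, smul_eq_mul, mul_one, pow_add]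
  push_cast
  linear_combination (-((j + k).choose j : ℝ) * (-1) ^ j * u (i + j)) * h1

theorem circ_per_mul (p : ℕ) (u : ℕ → ℝ) (hper : ∀ j, u (j + p) = u j) (i k : ℕ) :
    u (i + k * p) = u i := by
  induction k with
  | zero => simp
  | succ k ih => rw [Nat.succ_mul, ← add_assoc, hper, ih]

theorem circ_const_of_mono (p : ℕ) (hp : 2 ≤ p) (u : ℕ → ℝ) (hper : ∀ j, u (j + p) = u j)
    (hm : Monotone u) (i : ℕ) : u i = u 0 := by
  apply le_antisymm _ (hm (Nat.zero_le i))
  have := circ_per_mul p u hper 0 i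
  rw [← this]
  exact hm (by nlinarith)

theorem circ_const_of_sign (p : ℕ) (hp : 2 ≤ p) (u : ℕ → ℝ) (hper : ∀ j, u (j + p) = u j)
    (h : (∀ i, 0 ≤ fwdDiff 1 u i) ∨ (∀ i, fwdDiff 1 u i ≤ 0)) (i : ℕ) : u i = u 0 := by
  simp only [fwdDiff] at h
  rcases h with h | h
  · exact circ_const_of_mono p hp u hper (monotone_nat_of_le_succ fun n => by linarith [h n]) i
  · have := circ_const_of_mono p hp (fun n => - u n) (fun j => by simp [hper])
      (monotone_nat_of_le_succ fun n => by linarith [h n]) i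
    simpa using this

theorem circ_main (p : ℕ) (hp : 2 ≤ p) (M : ℕ) : ∀ (u : ℕ → ℝ), (∀ j, u (j + p) = u j) →
    ((∀ i, 0 ≤ (fwdDiff 1)^[M + 1] u i) ∨ (∀ i, (fwdDiff 1)^[M + 1] u i ≤ 0)) →
    ∀ i, u i = u 0 := by
  induction M with
  | zero => intro u hper h; exact circ_const_of_sign p hp u hper (by simpa using h)
  | succ M ih =>
    intro u hper h
    have hc := ih (fwdDiff 1 u)
      (fun j => by simp only [fwdDiff]; rw [add_right_comm, hper, hper])
      (by simpa only [Function.iterate_succ_apply (fwdDiff 1) (M + 1) u] using h)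
    apply circ_const_of_sign p hp u hper
    rcases le_total 0 (fwdDiff 1 u 0) with h0 | h0
    · left; intro i; rw [hc i]; exact h0
    · right; intro i; rw [hc i]; exact h0

/-- Theorem on circulant numbers: if `u` is `p`-periodic and the alternating binomial
sums of order `M` are all nonnegative (or all nonpositive) for `i = 0, …, p-1`, then
`u 0 = u 1 = ⋯ = u (p-1)`. -/
theorem circulant_numbers (M p : ℕ) (hM : 1 ≤ M) (hp : 2 ≤ p) (u : ℕ → ℝ)
    (hper : ∀ j, u (j + p) = u j)
    (h : (∀ i < p, 0 ≤ ∑ j ∈ Finset.range (M + 1), (M.choose j : ℝ) * (-1) ^ j * u (i + j)) ∨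
         (∀ i < p, ∑ j ∈ Finset.range (M + 1), (M.choose j : ℝ) * (-1) ^ j * u (i + j) ≤ 0)) :
    ∀ i < p, u i = u 0 := by
  obtain ⟨m, rfl⟩ := Nat.exists_eq_add_of_le' hM
  intro i _
  refine circ_main p hp m u hper ?_ i
  have hmod : ∀ i, ∑ j ∈ Finset.range (m + 1 + 1), ((m + 1).choose j : ℝ) * (-1) ^ j * u (i + j)
      = ∑ j ∈ Finset.range (m + 1 + 1), ((m + 1).choose j : ℝ) * (-1) ^ j * u (i % p + j) := by
    intro i
    refine Finset.sum_congr rfl fun j _ => ?_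
    congr 1
    rw [← circ_per_mul p u hper (i % p + j) (i / p)]
    congr 1
    have := Nat.mod_add_div' i p
    omega
  have hlt : ∀ i, i % p < p := fun i => Nat.mod_lt _ (by omega)
  rcases h with h | h
  · have h' : ∀ i, 0 ≤ (-1 : ℝ) ^ (m + 1) * (fwdDiff 1)^[m + 1] u i := fun i => by
      rw [← circ_sum_eq, hmod]; exact h _ (hlt i)
    rcases neg_one_pow_eq_or ℝ (m + 1) with e | e <;> rw [e] at h'
    · left; intro i; linarith [h' i]
    · right; intro i; linarith [h' i]
  · have h' : ∀ i, (-1 : ℝ) ^ (m + 1) * (fwdDiff 1)^[m + 1] u i ≤ 0 := fun i => by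
      rw [← circ_sum_eq, hmod]; exact h _ (hlt i)
    rcases neg_one_pow_eq_or ℝ (m + 1) with e | e <;> rw [e] at h'
    · right; intro i; linarith [h' i]
    · left; intro i; linarith [h' i]
end

section
/- Suppose the m-th order n-dimensional Hankel tensor generated by v is a generalized anti-circulant tensor with circulant index 1, where m = 2k ≥ 2 and n ≥ 2. Then the tensor is PSD if and only if v_0 ≥ 0, and in any case (circulant index 1) its Hankel polynomial satisfies f(x) = v_0·(x_1 + ⋯ + x_n)^m for all x ∈ ℝ^n. -/
/-- The Hankel polynomial `f(x) = ∑_{i₁,…,i_m = 1}^{n} v_{i₁+⋯+i_m−m} x_{i₁}⋯x_{i_m}`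
of the `m`-th order `n`-dimensional Hankel tensor generated by `v`
(indices here are 0-based). -/
noncomputable def hankelPoly (m n : ℕ) (v : ℕ → ℝ) (x : Fin n → ℝ) : ℝ :=
  ∑ i : Fin m → Fin n, v (∑ j, (i j : ℕ)) * ∏ j, x (i j)

/-- The `N × N` Hankel matrix generated by `v`, with entries `A_{ij} = v_{i+j-2}`
for 1-based indices, i.e. `v (i + j)` for 0-based indices. -/
noncomputable def hankelMatrix (N : ℕ) (v : ℕ → ℝ) : Matrix (Fin N) (Fin N) ℝ :=
  Matrix.of fun i j => v ((i : ℕ) + (j : ℕ))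
/-- Circulant index 1 case: the generalized anti-circulant tensor with circulant index 1
is PSD iff `v₀ ≥ 0`, and its Hankel polynomial is `v₀ (x₁ + ⋯ + x_n)^m`. -/
theorem anticirculant_index_one (m n k : ℕ) (hm : m = 2 * k) (hk : 1 ≤ k) (hn : 2 ≤ n)
    (v : ℕ → ℝ) (hac : ∀ i, i + 1 ≤ (n - 1) * m → v (i + 1) = v i) :
    ((∀ x : Fin n → ℝ, 0 ≤ hankelPoly m n v x) ↔ 0 ≤ v 0) ∧
    (∀ x : Fin n → ℝ, hankelPoly m n v x = v 0 * (∑ i, x i) ^ m) := by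
  have hv : ∀ i, i ≤ (n - 1) * m → v i = v 0 := by
    intro i
    induction i with
    | zero => intro _; rfl
    | succ i ih => intro h; rw [hac i h, ih (by omega)]
  have hf : ∀ x : Fin n → ℝ, hankelPoly m n v x = v 0 * (∑ i, x i) ^ m := by
    intro x
    unfold hankelPoly
    rw [← Fin.prod_const, Finset.prod_univ_sum, Fintype.piFinset_univ, Finset.mul_sum]
    refine Finset.sum_congr rfl fun i _ => ?_
    rw [hv]
    calc ∑ j, (i j : ℕ) ≤ ∑ _j : Fin m, (n - 1) :=
          Finset.sum_le_sum fun j _ => by have := (i j).isLt; omega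
      _ = (n - 1) * m := by simp [mul_comm]
  refine ⟨⟨fun h => ?_, fun h x => ?_⟩, hf⟩
  · have h1 := h (Pi.single ⟨0, by omega⟩ 1)
    rw [hf, Finset.sum_pi_single'] at h1
    simpa using h1
  · rw [hf, hm]
    exact mul_nonneg h (Even.pow_nonneg (even_two_mul k) _)
end

section
/- Suppose the m-th order n-dimensional Hankel tensor generated by v is a generalized anti-circulant tensor with circulant index r, where m = 2k, k ≥ 1, 1 ≤ r ≤ n, and GCD(m, r) = 1. Then the tensor is PSD if and only if v_0 = v_1 = ⋯ = v_{r−1} ≥ 0; moreover, in this case f(x) = v_0·(x_1 + ⋯ + x_n)^m for all x ∈ ℝ^n and the associated Hankel matrix is positive semidefinite (i.e., the tensor is a strong Hankel tensor). -/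
lemma hac_aux_map_sum {A ι : Type*} [AddCommMonoid A] (ψ : AddChar A ℂ) (s : Finset ι)
    (g : ι → A) : ψ (∑ i ∈ s, g i) = ∏ i ∈ s, ψ (g i) := by
  classical
  induction s using Finset.induction_on with
  | empty => simp
  | insert a s ha ih => rw [Finset.sum_insert ha, Finset.prod_insert ha, AddChar.map_add_eq_mul, ih]

open ZMod in
lemma hac_aux_exp {r : ℕ} [NeZero r] (V : ZMod r → ℂ) :
    ∃ c : ZMod r → ℂ, ∀ s, V s = ∑ j, c j * stdAddChar (j * s) := by
  refine ⟨fun j => (r : ℂ)⁻¹ * ZMod.dft V j, fun s => ?_⟩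
  have h := invDFT_apply (ZMod.dft V) s
  rw [LinearEquiv.symm_apply_apply] at h
  rw [h, smul_eq_mul, Finset.mul_sum]
  refine Finset.sum_congr rfl fun j _ => ?_
  simp only [smul_eq_mul]; ring

open ZMod in
lemma hac_aux_poly {r : ℕ} [NeZero r] (m n : ℕ) (v : ℕ → ℝ) (c : ZMod r → ℂ)
    (hv : ∀ s : ℕ, s ≤ (n - 1) * m → (v s : ℂ) = ∑ j, c j * stdAddChar (j * (s : ZMod r)))
    (x : Fin n → ℝ) :
    (hankelPoly m n v x : ℂ) =
      ∑ j, c j * (∑ a : Fin n, stdAddChar (j * ((a : ℕ) : ZMod r)) * (x a : ℂ)) ^ m := by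
  unfold hankelPoly
  push_cast
  simp_rw [Fintype.sum_pow, Finset.mul_sum]
  rw [Finset.sum_comm]
  refine Finset.sum_congr rfl fun i _ => ?_
  have hle : ∑ j, (i j : ℕ) ≤ (n - 1) * m := by
    calc ∑ j, (i j : ℕ) ≤ ∑ j : Fin m, (n - 1) := Finset.sum_le_sum fun j _ => by omega
      _ = (n - 1) * m := by simp [mul_comm]
  rw [hv _ hle, Finset.sum_mul]
  refine Finset.sum_congr rfl fun j _ => ?_
  rw [Finset.prod_mul_distrib, mul_assoc]
  congr 2
  push_cast
  rw [Finset.mul_sum]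
  exact hac_aux_map_sum _ _ _

lemma hac_aux_reindex {r : ℕ} [NeZero r] (n : ℕ) (hrn : r ≤ n) (g : ZMod r → ℂ) :
    ∑ a : Fin n, (if (a : ℕ) < r then g ((a : ℕ) : ZMod r) else 0) = ∑ b, g b := by
  rw [Fin.sum_univ_eq_sum_range (fun a => if a < r then g (a : ZMod r) else 0) n]
  rw [← Finset.sum_filter]
  refine Finset.sum_bij' (fun a _ => (a : ZMod r)) (fun b _ => b.val) ?_ ?_ ?_ ?_ ?_
  · simp
  · intro b _
    have := ZMod.val_lt b
    simp; omega
  · intro a ha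
    simp at ha
    exact ZMod.val_cast_of_lt ha.2
  · intro b _; simp
  · simp

open ZMod ComplexConjugate in
lemma hac_aux_zero {r : ℕ} [NeZero r] (hodd : Odd r) (m n : ℕ) (hm : 0 < m) (hrn : r ≤ n)
    (v : ℕ → ℝ) (c : ZMod r → ℂ)
    (hv : ∀ s : ℕ, s ≤ (n - 1) * m → (v s : ℂ) = ∑ j, c j * stdAddChar (j * (s : ZMod r)))
    (hpsd : ∀ x : Fin n → ℝ, 0 ≤ hankelPoly m n v x) (j0 : ZMod r) (hj0 : j0 ≠ 0) :
    c j0 = 0 := by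
  have hr0 : (r : ℂ) ≠ 0 := by exact_mod_cast NeZero.ne r
  have hne : j0 ≠ -j0 := ZMod.ne_neg_self hodd hj0
  have key : ∀ z : ℂ, ∃ t : ℝ, 0 ≤ t ∧
      (t : ℂ) = c (-j0) * (r * z) ^ m + c j0 * (r * conj z) ^ m := by
    intro z
    let y : ZMod r → ℝ := fun b => 2 * (stdAddChar (j0 * b) * z).re
    have hy : ∀ b, (y b : ℂ) = stdAddChar (b * j0) * z + stdAddChar (b * (-j0)) * conj z := by
      intro b
      have h1 : stdAddChar (b * (-j0)) = conj (stdAddChar (b * j0)) := by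
        rw [mul_neg, AddChar.map_neg_eq_conj]
      rw [h1, ← map_mul, Complex.add_conj]
      simp only [y, mul_comm j0]
    refine ⟨_, hpsd (fun a => if (a : ℕ) < r then y ((a : ℕ) : ZMod r) else 0), ?_⟩
    rw [hac_aux_poly m n v c hv]
    have hX : ∀ j : ZMod r, ∑ a : Fin n, stdAddChar (j * ((a : ℕ) : ZMod r)) *
        (((if (a : ℕ) < r then y ((a : ℕ) : ZMod r) else 0 : ℝ)) : ℂ)
        = (if j = -j0 then r * z else 0) + (if j = j0 then r * conj z else 0) := by
      intro j
      have := hac_aux_reindex n hrn (fun b => stdAddChar (j * b) * (y b : ℂ))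
      have e : ∑ b, stdAddChar (j * b) * (y b : ℂ) =
          (∑ b, stdAddChar (b * (j + j0))) * z + (∑ b, stdAddChar (b * (j - j0))) * conj z := by
        rw [Finset.sum_mul, Finset.sum_mul, ← Finset.sum_add_distrib]
        refine Finset.sum_congr rfl fun b _ => ?_
        rw [hy, sub_eq_add_neg, mul_add b, mul_add b, AddChar.map_add_eq_mul,
          AddChar.map_add_eq_mul, mul_comm j b]
        ring
      rw [AddChar.sum_mulShift _ (isPrimitive_stdAddChar r),
        AddChar.sum_mulShift _ (isPrimitive_stdAddChar r)] at e
      rw [e] at this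
      simp only [← eq_neg_iff_add_eq_zero, sub_eq_zero] at this
      convert this using 1
      · refine Finset.sum_congr rfl fun a _ => ?_
        split_ifs <;> simp
      · simp [ZMod.card]
    simp_rw [hX]
    rw [Finset.sum_eq_add (-j0) j0 hne.symm]
    · simp [hne, hne.symm]
    · intro j _ hj
      simp [hj.1, hj.2, hm.ne']
    · simp
    · simp
  have key0 : ∀ z : ℂ, c (-j0) * z ^ m + c j0 * (conj z) ^ m = 0 := by
    intro z
    obtain ⟨w, hw⟩ := IsAlgClosed.exists_pow_nat_eq (-1 : ℂ) hm
    obtain ⟨t, ht, e⟩ := key z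
    obtain ⟨t2, ht2, e2⟩ := key (w * z)
    have hw2 : (conj w) ^ m = -1 := by rw [← map_pow, hw]; simp
    have h2 : (t2 : ℂ) = -t := by
      rw [e, e2, map_mul]
      simp only [mul_pow, hw, hw2]; ring
    have h3 : t2 = -t := by exact_mod_cast h2
    have h4 : t = 0 := by linarith
    rw [h4] at e
    have h5 : (r : ℂ) ^ m * (c (-j0) * z ^ m + c j0 * (conj z) ^ m) = 0 := by
      simp only [mul_pow, Complex.ofReal_zero] at e
      linear_combination -e
    exact (mul_eq_zero.1 h5).resolve_left (pow_ne_zero _ hr0)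
  obtain ⟨w, hw⟩ := IsAlgClosed.exists_pow_nat_eq Complex.I hm
  have a1 := key0 1
  have a2 := key0 w
  rw [← map_pow, hw, Complex.conj_I] at a2
  simp only [map_one, one_pow, mul_one] at a1
  linear_combination a1 / 2 + Complex.I / 2 * a2 + (c j0 - c (-j0)) / 2 * Complex.I_sq

lemma hac_aux_periodic {r M : ℕ} (hr1 : 1 ≤ r) (v : ℕ → ℝ)
    (hac : ∀ i, i + r ≤ M → v (i + r) = v i) : ∀ s ≤ M, v s = v (s % r) := by
  intro s
  induction s using Nat.strong_induction_on with
  | _ s ih =>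
    intro hs
    by_cases h : s < r
    · rw [Nat.mod_eq_of_lt h]
    · have h1 := hac (s - r) (by omega)
      rw [Nat.sub_add_cancel (by omega)] at h1
      rw [h1, ih (s - r) (by omega) (by omega), Nat.mod_eq_sub_mod (a := s) (by omega)]

/-- The case `GCD(m, r) = 1`: the generalized anti-circulant tensor is PSD iff
`v₀ = ⋯ = v_{r-1} ≥ 0`; in this case `f(x) = v₀ (x₁ + ⋯ + x_n)^m` and the
associated Hankel matrix is positive semidefinite (the tensor is a strong Hankel tensor). -/
theorem anticirculant_gcd_one (m n k r : ℕ) (hm : m = 2 * k) (hk : 1 ≤ k) (hn : 2 ≤ n)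
    (hr1 : 1 ≤ r) (hrn : r ≤ n) (hgcd : Nat.gcd m r = 1)
    (v : ℕ → ℝ) (hac : ∀ i, i + r ≤ (n - 1) * m → v (i + r) = v i) :
    ((∀ x : Fin n → ℝ, 0 ≤ hankelPoly m n v x) ↔ ((∀ i < r, v i = v 0) ∧ 0 ≤ v 0)) ∧
    (((∀ i < r, v i = v 0) ∧ 0 ≤ v 0) →
      (∀ x : Fin n → ℝ, hankelPoly m n v x = v 0 * (∑ i, x i) ^ m) ∧
      (hankelMatrix (n * k - k + 1) v).PosSemidef) := by
  have hper := hac_aux_periodic hr1 v hac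
  have hall : (∀ i < r, v i = v 0) → ∀ s ≤ (n - 1) * m, v s = v 0 := fun h s hs => by
    rw [hper s hs, h _ (Nat.mod_lt _ hr1)]
  have hf : (∀ i < r, v i = v 0) →
      ∀ x : Fin n → ℝ, hankelPoly m n v x = v 0 * (∑ i, x i) ^ m := by
    intro h x
    unfold hankelPoly
    rw [Fintype.sum_pow, Finset.mul_sum]
    refine Finset.sum_congr rfl fun i _ => ?_
    rw [hall h]
    calc ∑ j, (i j : ℕ) ≤ ∑ j : Fin m, (n - 1) := Finset.sum_le_sum fun j _ => by omega
      _ = (n - 1) * m := by simp [mul_comm]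
  refine ⟨⟨fun hpsd => ?_, fun h x => ?_⟩, fun h => ⟨hf h.1, ?_⟩⟩
  · have : NeZero r := ⟨by omega⟩
    have hodd : Odd r := by
      rw [← Nat.not_even_iff_odd]
      intro he
      have : 2 ∣ Nat.gcd m r := Nat.dvd_gcd ⟨k, hm⟩ he.two_dvd
      omega
    obtain ⟨c, hc⟩ := hac_aux_exp (fun a : ZMod r => (v a.val : ℂ))
    have hv : ∀ s : ℕ, s ≤ (n - 1) * m →
        (v s : ℂ) = ∑ j, c j * ZMod.stdAddChar (j * (s : ZMod r)) := by
      intro s hs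
      rw [← hc, ZMod.val_natCast, hper s hs]
    have hz := hac_aux_zero hodd m n (by omega) hrn v c hv hpsd
    have hconst : ∀ s : ZMod r, (v s.val : ℂ) = c 0 := by
      intro s
      have := hc s
      rw [Finset.sum_eq_single 0 (fun j _ hj => by rw [hz j hj, zero_mul]) (by simp)] at this
      simpa using this
    have h1 : ∀ i < r, v i = v 0 := by
      intro i hi
      have e1 := hconst (i : ZMod r)
      have e2 := hconst 0
      rw [ZMod.val_cast_of_lt hi] at e1
      rw [ZMod.val_zero] at e2
      exact_mod_cast e1.trans e2.symm
    refine ⟨h1, ?_⟩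
    have := hpsd (Pi.single ⟨0, by omega⟩ 1)
    rw [hf h1] at this
    simpa using this
  · rw [hf h.1]
    exact mul_nonneg h.2 ((Even.pow_nonneg ⟨k, by omega⟩) _)
  · have e : hankelMatrix (n * k - k + 1) v =
        v 0 • Matrix.vecMulVec (fun _ => (1 : ℝ)) (star fun _ => (1 : ℝ)) := by
      ext i j
      have hij : (i : ℕ) + j ≤ (n - 1) * m := by
        have e1 : (n - 1) * m = 2 * (n * k - k) := by
          rw [hm, Nat.mul_left_comm, Nat.sub_mul, one_mul]
        omega
      simp [hankelMatrix, Matrix.vecMulVec_apply, hall h.1 _ hij]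
    rw [e]
    exact (Matrix.posSemidef_vecMulVec_self_star _).smul h.2
end

section
/- Suppose the m-th order n-dimensional Hankel tensor generated by v is a generalized anti-circulant tensor with circulant index 3, where m ∈ {6, 12, 18, 30, 42} and n ≥ 3, and assume v_0 ≥ 0. If the tensor is PSD, then v_1 + v_2 = 2·v_0. -/
/-- primitive cube root of unity -/
noncomputable def cubeOm : ℂ := ⟨-1/2, Real.sqrt 3 / 2⟩

lemma cubeOm_sq : cubeOm ^ 2 = ⟨-1/2, -(Real.sqrt 3 / 2)⟩ := by
  have h3 : Real.sqrt 3 * Real.sqrt 3 = 3 := Real.mul_self_sqrt (by norm_num)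
  rw [pow_two]
  apply Complex.ext
  · simp only [cubeOm, Complex.mul_re]; linarith
  · simp only [cubeOm, Complex.mul_im]; ring

lemma cubeOm_cube : cubeOm ^ 3 = 1 := by
  have h3 : Real.sqrt 3 * Real.sqrt 3 = 3 := Real.mul_self_sqrt (by norm_num)
  rw [pow_succ, cubeOm_sq]
  apply Complex.ext
  · simp only [cubeOm, Complex.mul_re, Complex.one_re]; linarith
  · simp only [cubeOm, Complex.mul_im, Complex.one_im]; ring

lemma v_rep (N : ℕ) (v : ℕ → ℝ) (hN : 2 ≤ N) (hac : ∀ i, i + 3 ≤ N → v (i + 3) = v i) :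
    ∃ (a : ℝ) (c : ℂ), c.re = (2 * v 0 - v 1 - v 2) / 3 ∧
      ∀ k, k ≤ N → v k = a + (c * cubeOm ^ k).re := by
  have h3 : Real.sqrt 3 * Real.sqrt 3 = 3 := Real.mul_self_sqrt (by norm_num)
  refine ⟨(v 0 + v 1 + v 2) / 3,
    ⟨(2 * v 0 - v 1 - v 2) / 3, (v 2 - v 1) * Real.sqrt 3 / 3⟩, rfl, ?_⟩
  intro k
  induction k using Nat.strong_induction_on with
  | _ k ih =>
    intro hk
    match k, ih, hk with
    | 0, _, _ => simp; ring
    | 1, _, _ =>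
      rw [pow_one]
      simp only [cubeOm, Complex.mul_re]
      linear_combination (v 2 - v 1) / 6 * h3
    | 2, _, _ =>
      rw [cubeOm_sq]
      simp only [Complex.mul_re]
      linear_combination -(v 2 - v 1) / 6 * h3
    | j + 3, ih, hk =>
      rw [hac j hk, pow_add, cubeOm_cube, mul_one]
      exact ih j (by omega) (by omega)

lemma hankel_rep (m n : ℕ) (hn : 1 ≤ n) (v : ℕ → ℝ) (a : ℝ) (c : ℂ)
    (h : ∀ k, k ≤ (n - 1) * m → v k = a + (c * cubeOm ^ k).re) (x : Fin n → ℝ) :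
    hankelPoly m n v x = a * (∑ i, x i) ^ m
      + (c * (∑ i : Fin n, (x i : ℂ) * cubeOm ^ (i : ℕ)) ^ m).re := by
  rw [Fintype.sum_pow, Fintype.sum_pow, Finset.mul_sum, Finset.mul_sum, Complex.re_sum,
    ← Finset.sum_add_distrib, hankelPoly]
  refine Finset.sum_congr rfl fun p _ => ?_
  have hb : ∑ j, (p j : ℕ) ≤ (n - 1) * m := by
    calc ∑ j, (p j : ℕ) ≤ ∑ _j : Fin m, (n - 1) :=
          Finset.sum_le_sum fun j _ => by have := (p j).2; omega
      _ = (n - 1) * m := by simp [mul_comm]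
  rw [h _ hb, Finset.prod_mul_distrib, Finset.prod_pow_eq_pow_sum, ← Complex.ofReal_prod]
  rw [mul_left_comm, Complex.re_ofReal_mul]
  ring

lemma re_nonneg_all (m n : ℕ) (hm : m ≠ 0) (hn : 3 ≤ n) (v : ℕ → ℝ) (a : ℝ) (c : ℂ)
    (h : ∀ k, k ≤ (n - 1) * m → v k = a + (c * cubeOm ^ k).re)
    (hpsd : ∀ x : Fin n → ℝ, 0 ≤ hankelPoly m n v x) (w : ℂ) : 0 ≤ (c * w ^ m).re := by
  have h3 : Real.sqrt 3 * Real.sqrt 3 = 3 := Real.mul_self_sqrt (by norm_num)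
  obtain ⟨k, rfl⟩ : ∃ k, n = k + 3 := ⟨n - 3, by omega⟩
  let y : ℕ → ℝ := fun i => if i = 0 then 2 * w.re / 3 else if i = 1 then
    (-w.re + w.im * Real.sqrt 3) / 3 else if i = 2 then (-w.re - w.im * Real.sqrt 3) / 3 else 0
  have hy0 : y 0 = 2 * w.re / 3 := by simp [y]
  have hy1 : y 1 = (-w.re + w.im * Real.sqrt 3) / 3 := by simp [y]
  have hy2 : y 2 = (-w.re - w.im * Real.sqrt 3) / 3 := by simp [y]
  have hy3 : ∀ i, y (i + 3) = 0 := by intro i; simp [y]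
  have key := hpsd (fun i => y i)
  rw [hankel_rep m (k + 3) (by omega) v a c h] at key
  have e1 : ∑ i : Fin (k + 3), y i = 0 := by
    rw [Fin.sum_univ_eq_sum_range, add_comm, Finset.sum_range_add,
      Finset.sum_eq_zero (s := Finset.range k) (fun i _ => by rw [add_comm]; exact hy3 i)]
    simp only [Finset.sum_range_succ, Finset.sum_range_zero, hy0, hy1, hy2]
    ring
  have e2 : ∑ i : Fin (k + 3), (y i : ℂ) * cubeOm ^ (i : ℕ) = w := by
    rw [Fin.sum_univ_eq_sum_range (fun i => (y i : ℂ) * cubeOm ^ i), add_comm,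
      Finset.sum_range_add,
      Finset.sum_eq_zero (s := Finset.range k)
        (fun i _ => by rw [add_comm 3 i, hy3 i]; simp)]
    simp only [Finset.sum_range_succ, Finset.sum_range_zero, hy0, hy1, hy2, pow_zero, pow_one,
      cubeOm_sq]
    apply Complex.ext
    · simp only [cubeOm, Complex.add_re, Complex.re_ofReal_mul, Complex.zero_re, Complex.one_re]
      ring
    · simp only [cubeOm, Complex.add_im, Complex.im_ofReal_mul, Complex.zero_im, Complex.one_im]
      linear_combination w.im / 3 * h3
  rw [e1, e2, zero_pow hm] at key
  simpa using key

/-- For `m ∈ {6, 12, 18, 30, 42}`, `n ≥ 3`, circulant index 3, `v₀ ≥ 0`: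
if the tensor is PSD then `v₁ + v₂ = 2 v₀`. -/
theorem anticirculant_index_three_nec (m n : ℕ) (hm : m ∈ ({6, 12, 18, 30, 42} : Set ℕ))
    (hn : 3 ≤ n) (v : ℕ → ℝ) (hac : ∀ i, i + 3 ≤ (n - 1) * m → v (i + 3) = v i)
    (hv0 : 0 ≤ v 0)
    (hpsd : ∀ x : Fin n → ℝ, 0 ≤ hankelPoly m n v x) :
    v 1 + v 2 = 2 * v 0 := by
  have hm0 : m ≠ 0 := by
    rintro rfl
    simp at hm
  have hN : 2 ≤ (n - 1) * m := by
    have h1 : 2 ≤ n - 1 := by omega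
    have h2 : 1 ≤ m := by omega
    nlinarith
  obtain ⟨a, c, hc, h⟩ := v_rep _ v hN hac
  have H := re_nonneg_all m n hm0 hn v a c h hpsd
  have p1 := H 1
  obtain ⟨w, hw⟩ := IsAlgClosed.exists_pow_nat_eq (-1 : ℂ) (Nat.pos_of_ne_zero hm0)
  have p2 := H w
  rw [hw] at p2
  simp only [one_pow, mul_one, mul_neg, Complex.neg_re] at p1 p2
  linarith
end

section
/- Suppose the m-th order n-dimensional Hankel tensor generated by v is a generalized anti-circulant tensor with circulant index 3, where m ∈ {6, 12, 18, 30, 42} and n ≥ 3. Then the tensor is PSD if and only if v_0 = v_1 = v_2 ≥ 0; moreover, in this case f(x) = v_0·(x_1 + ⋯ + x_n)^m for all x ∈ ℝ^n and the associated Hankel matrix is positive semidefinite (i.e., the tensor is a strong Hankel tensor). -/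
theorem hp_geom (m n : ℕ) (v : ℕ → ℝ) (a : ℝ) (C w : ℂ) 
    (hv : ∀ k, k ≤ (n - 1) * m → v k = a + (C * w ^ k).re) (x : Fin n → ℝ) :
    hankelPoly m n v x = a * (∑ i, x i) ^ m + (C * (∑ i, (x i : ℂ) * w ^ (i : ℕ)) ^ m).re := by
  unfold hankelPoly
  rw [Fintype.sum_pow, Fintype.sum_pow, Finset.mul_sum, Finset.mul_sum, Complex.re_sum,
    ← Finset.sum_add_distrib]
  refine Finset.sum_congr rfl fun p _ => ?_
  have hb : ∑ j, (p j : ℕ) ≤ (n - 1) * m := by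
    calc ∑ j, (p j : ℕ) ≤ ∑ j : Fin m, (n - 1) :=
          Finset.sum_le_sum fun j _ => by have := (p j).2; omega
      _ = (n - 1) * m := by simp [mul_comm]
  rw [hv _ hb, Finset.prod_mul_distrib, Finset.prod_pow_eq_pow_sum, ← Complex.ofReal_prod]
  have : C * (((∏ i, x (p i) : ℝ) : ℂ) * w ^ (∑ j, (p j : ℕ)))
      = ((∏ i, x (p i) : ℝ) : ℂ) * (C * w ^ (∑ j, (p j : ℕ))) := by ring
  rw [this, Complex.re_ofReal_mul]
  ring

theorem v_mod (N : ℕ) (v : ℕ → ℝ) (hac : ∀ i, i + 3 ≤ N → v (i + 3) = v i) :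
    ∀ k, k ≤ N → v k = v (k % 3) := by
  intro k
  induction k using Nat.strong_induction_on with
  | _ k ih =>
    intro hk
    by_cases h : k < 3
    · rw [Nat.mod_eq_of_lt h]
    · obtain ⟨j, rfl⟩ : ∃ j, k = j + 3 := ⟨k - 3, by omega⟩
      rw [hac j hk, ih j (by omega) (by omega), Nat.add_mod_right]

theorem v_repr (N : ℕ) (v : ℕ → ℝ) (hac : ∀ i, i + 3 ≤ N → v (i + 3) = v i) (k : ℕ)
    (hk : k ≤ N) : v k = (v 0 + v 1 + v 2) / 3 +
      ((⟨v 0 - (v 0 + v 1 + v 2) / 3, (v 2 - v 1) / √3⟩ : ℂ) * (⟨-1 / 2, √3 / 2⟩ : ℂ) ^ k).re := by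
  have h3 : √3 * √3 = 3 := Real.mul_self_sqrt (by norm_num)
  have h30 : √3 ≠ 0 := by positivity
  have h2 : (⟨-1 / 2, √3 / 2⟩ : ℂ) ^ 2 = ⟨-1 / 2, -(√3 / 2)⟩ := by
    apply Complex.ext <;> simp [pow_two] <;> nlinarith
  have hw : (⟨-1 / 2, √3 / 2⟩ : ℂ) ^ 3 = 1 := by
    rw [pow_succ, h2]
    apply Complex.ext <;> simp <;> nlinarith
  rw [v_mod N v hac k hk, pow_eq_pow_mod k hw]
  have : k % 3 < 3 := Nat.mod_lt _ (by norm_num)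
  interval_cases k % 3
  · simp
  · simp; field_simp; ring
  · rw [h2]; simp; field_simp; ring

theorem const_part (m n : ℕ) (hm : Even m) (hn : 1 ≤ n) (v : ℕ → ℝ)
    (hac : ∀ i, i + 3 ≤ (n - 1) * m → v (i + 3) = v i) (h01 : v 0 = v 1) (h12 : v 1 = v 2)
    (h0 : 0 ≤ v 0) :
      (∀ x : Fin n → ℝ, hankelPoly m n v x = v 0 * (∑ i, x i) ^ m) ∧
      (hankelMatrix (n * (m / 2) - m / 2 + 1) v).PosSemidef := by
  have hc : ∀ k, k ≤ (n - 1) * m → v k = v 0 := by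
    intro k hk
    rw [v_mod _ v hac k hk]
    have : k % 3 < 3 := Nat.mod_lt _ (by norm_num)
    interval_cases k % 3
    · rfl
    · exact h01.symm
    · rw [h01, h12]
  constructor
  · intro x
    rw [hp_geom m n v (v 0) 0 0 (by simpa using hc)]
    simp
  · obtain ⟨r, rfl⟩ := hm
    have hr : (r + r) / 2 = r := by omega
    rw [hr]
    have e : hankelMatrix (n * r - r + 1) v
        = v 0 • Matrix.vecMulVec (fun _ => (1 : ℝ)) (star fun _ => (1 : ℝ)) := by
      ext i j
      have hi := i.2
      have hj := j.2
      have h1 : (n - 1) * (r + r) = 2 * (n * r - r) := by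
        rw [← Nat.sub_one_mul]; ring
      simp [hankelMatrix, Matrix.vecMulVec]
      exact hc _ (by omega)
    rw [e]
    exact (Matrix.posSemidef_vecMulVec_self_star _).smul h0

theorem nec_part (m n : ℕ) (hm : 0 < m) (hn : 3 ≤ n) (v : ℕ → ℝ)
    (hac : ∀ i, i + 3 ≤ (n - 1) * m → v (i + 3) = v i)
    (h : ∀ x : Fin n → ℝ, 0 ≤ hankelPoly m n v x) : v 0 = v 1 ∧ v 1 = v 2 ∧ 0 ≤ v 0 := by
  obtain ⟨k, rfl⟩ : ∃ k, n = k + 3 := ⟨n - 3, by omega⟩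
  have h3 : √3 * √3 = 3 := Real.mul_self_sqrt (by norm_num)
  have h30 : √3 ≠ 0 := by positivity
  have hr := hp_geom m (k + 3) v _ _ _ (v_repr _ v hac)
  set C : ℂ := ⟨v 0 - (v 0 + v 1 + v 2) / 3, (v 2 - v 1) / √3⟩ with hC
  have h2 : (⟨-1 / 2, √3 / 2⟩ : ℂ) ^ 2 = ⟨-1 / 2, -(√3 / 2)⟩ := by
    apply Complex.ext <;> simp [pow_two] <;> nlinarith
  obtain ⟨z, hz⟩ := IsAlgClosed.exists_pow_nat_eq (-(starRingEnd ℂ) C) hm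
  have key := h (Fin.cons (2 * z.re / 3) (Fin.cons (-z.re / 3 + z.im / √3)
    (Fin.cons (-z.re / 3 - z.im / √3) (fun _ : Fin k => (0 : ℝ)))))
  rw [hr] at key
  have es : ((2 * z.re / 3 : ℝ) : ℂ) + (((-z.re / 3 + z.im / √3 : ℝ) : ℂ) * (⟨-1 / 2, √3 / 2⟩ : ℂ)
      + ((-z.re / 3 - z.im / √3 : ℝ) : ℂ) * (⟨-1 / 2, -(√3 / 2)⟩ : ℂ)) = z := by
    apply Complex.ext
    · simp only [Complex.add_re, Complex.re_ofReal_mul, Complex.ofReal_re]; ring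
    · simp only [Complex.add_im, Complex.im_ofReal_mul, Complex.ofReal_im]; field_simp; ring
  have s1 : 2 * z.re / 3 + (-z.re / 3 + z.im / √3 + (-z.re / 3 - z.im / √3)) = 0 := by ring
  simp only [Fin.sum_univ_succ, Fin.cons_zero, Fin.cons_succ, Fin.val_zero, Fin.val_succ, pow_zero,
    mul_one, zero_add, pow_one, Nat.reduceAdd, h2, Complex.ofReal_zero, zero_mul,
    Finset.sum_const_zero, add_zero, es, s1, zero_pow hm.ne', mul_zero, hz] at key
  have hC0 : C = 0 := by
    rw [mul_neg, Complex.mul_conj, Complex.neg_re, Complex.ofReal_re] at key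
    exact Complex.normSq_eq_zero.1 (le_antisymm (by linarith) (Complex.normSq_nonneg _))
  have hre := congrArg Complex.re hC0
  have him := congrArg Complex.im hC0
  simp only [hC, Complex.zero_re, Complex.zero_im, div_eq_zero_iff, h30, or_false] at hre him
  have k2 := h (Fin.cons 1 fun _ => 0)
  rw [hr, hC0] at k2
  simp [Fin.sum_univ_succ] at k2
  refine ⟨by linarith, by linarith, by linarith⟩

/-- For `m ∈ {6, 12, 18, 30, 42}`, `n ≥ 3`, circulant index 3: the tensor is PSD iff
`v₀ = v₁ = v₂ ≥ 0`; in this case `f(x) = v₀ (x₁ + ⋯ + x_n)^m` and the associated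
Hankel matrix is positive semidefinite (the tensor is a strong Hankel tensor). -/
theorem anticirculant_index_three (m n : ℕ) (hm : m ∈ ({6, 12, 18, 30, 42} : Set ℕ))
    (hn : 3 ≤ n) (v : ℕ → ℝ) (hac : ∀ i, i + 3 ≤ (n - 1) * m → v (i + 3) = v i) :
    ((∀ x : Fin n → ℝ, 0 ≤ hankelPoly m n v x) ↔ (v 0 = v 1 ∧ v 1 = v 2 ∧ 0 ≤ v 0)) ∧
    ((v 0 = v 1 ∧ v 1 = v 2 ∧ 0 ≤ v 0) →
      (∀ x : Fin n → ℝ, hankelPoly m n v x = v 0 * (∑ i, x i) ^ m) ∧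
      (hankelMatrix (n * (m / 2) - m / 2 + 1) v).PosSemidef) := by
  have h2 : Even m ∧ 0 < m := by
    rcases hm with rfl | rfl | rfl | rfl | rfl <;> decide
  have hc := const_part m n h2.1 (by omega) v hac
  refine ⟨⟨nec_part m n h2.2 hn v hac, fun ⟨a, b, c⟩ x => ?_⟩, fun ⟨a, b, c⟩ => hc a b c⟩
  rw [(hc a b c).1 x]
  exact mul_nonneg c (h2.1.pow_nonneg _)
end

section
/- Let m be a positive integer divisible by 6. Then Σ {(−1)^p · C(m,p) : 0 ≤ p ≤ m, p ≡ 1 (mod 3)} = Σ {(−1)^p · C(m,p) : 0 ≤ p ≤ m, p ≡ 2 (mod 3)}. -/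
/-- For `m` a positive multiple of 6, the alternating binomial sums over residues
1 and 2 mod 3 coincide. -/
theorem alt_binom_sum_mod3_one_eq_two (m : ℕ) (hm : 0 < m) (h6 : 6 ∣ m) :
    ∑ p ∈ (Finset.range (m + 1)).filter (fun p => p % 3 = 1), (-1 : ℝ) ^ p * (m.choose p) =
    ∑ p ∈ (Finset.range (m + 1)).filter (fun p => p % 3 = 2), (-1 : ℝ) ^ p * (m.choose p) := by
  refine Finset.sum_bij' (fun p _ => m - p) (fun p _ => m - p) ?_ ?_ ?_ ?_ ?_
  · intro p hp
    simp only [Finset.mem_filter, Finset.mem_range] at hp ⊢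
    omega
  · intro p hp
    simp only [Finset.mem_filter, Finset.mem_range] at hp ⊢
    omega
  · intro p hp
    simp only [Finset.mem_filter, Finset.mem_range] at hp
    omega
  · intro p hp
    simp only [Finset.mem_filter, Finset.mem_range] at hp
    omega
  · intro p hp
    simp only [Finset.mem_filter, Finset.mem_range] at hp
    have hle : p ≤ m := by omega
    rw [Nat.choose_symm hle, neg_one_pow_eq_pow_mod_two, neg_one_pow_eq_pow_mod_two (n := m - p)]
    have h : (m - p) % 2 = p % 2 := by omega
    rw [h]
end

section
/- Let m be a positive integer divisible by 3. Then Σ {(−2)^p · C(m,p) · C(m−p,q) : 0 ≤ p ≤ m, 0 ≤ q ≤ m−p, 2p + q ≡ 1 (mod 3)} = Σ {(−2)^p · C(m,p) · C(m−p,q) : 0 ≤ p ≤ m, 0 ≤ q ≤ m−p, 2p + q ≡ 2 (mod 3)}. -/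
lemma omega_im (w : ℂ) (h1 : w ^ 3 = 1) (h2 : (w ^ 2).im = - w.im) (n : ℕ) :
    (w ^ n).im = w.im * ((if n % 3 = 1 then 1 else 0) - (if n % 3 = 2 then 1 else 0)) := by
  have h : w ^ n = w ^ (n % 3) := by
    conv_lhs => rw [← Nat.div_add_mod n 3, pow_add, pow_mul, h1, one_pow, one_mul]
  rw [h]
  have h3 : n % 3 < 3 := Nat.mod_lt _ (by norm_num)
  generalize n % 3 = k at h3 ⊢
  interval_cases k
  · simp
  · simp
  · simp [h2]

lemma sum_omega (w : ℂ) (m : ℕ) :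
    ∑ p ∈ Finset.range (m + 1), ∑ q ∈ Finset.range (m - p + 1),
      (((-2 : ℝ) ^ p * (m.choose p) * ((m - p).choose q) : ℝ) : ℂ) * w ^ (2 * p + q)
      = (-2 * w ^ 2 + (w + 1)) ^ m := by
  rw [add_pow]
  refine Finset.sum_congr rfl fun p _ => ?_
  rw [add_pow, Finset.mul_sum, Finset.sum_mul]
  refine Finset.sum_congr rfl fun q _ => ?_
  push_cast
  rw [mul_pow, pow_add, pow_mul, one_pow]
  ring

/-- For `m` a positive multiple of 3, the double binomial sums with weight `(−2)^p`
over residues 1 and 2 mod 3 coincide. -/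
theorem double_binom_sum_one_eq_two (m : ℕ) (hm : 0 < m) (h3 : 3 ∣ m) :
    (∑ p ∈ Finset.range (m + 1), ∑ q ∈ Finset.range (m - p + 1),
      (if (2 * p + q) % 3 = 1 then (-2 : ℝ) ^ p * (m.choose p) * ((m - p).choose q) else 0)) =
    (∑ p ∈ Finset.range (m + 1), ∑ q ∈ Finset.range (m - p + 1),
      (if (2 * p + q) % 3 = 2 then (-2 : ℝ) ^ p * (m.choose p) * ((m - p).choose q) else 0)) := by
  have hs : √(3:ℝ) * √3 = 3 := Real.mul_self_sqrt (by norm_num)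
  obtain ⟨w, hq, him⟩ : ∃ w : ℂ, w ^ 2 + w + 1 = 0 ∧ w.im ≠ 0 := by
    refine ⟨⟨-1/2, √3/2⟩, ?_, ?_⟩
    · apply Complex.ext
      · simp [pow_two]; linarith
      · simp [pow_two]; ring
    · simp
  have h1 : w ^ 3 = 1 := by linear_combination (w - 1) * hq
  have h2 : (w ^ 2).im = - w.im := by
    have : w ^ 2 = - w - 1 := by linear_combination hq
    rw [this]; simp
  have key := congrArg Complex.im (sum_omega w m)
  have hr : (-2 * w ^ 2 + (w + 1)) ^ m = (((-27 : ℝ) ^ (m / 3) : ℝ) : ℂ) := by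
    obtain ⟨k, rfl⟩ := h3
    have h : -2 * w ^ 2 + (w + 1) = -3 * w ^ 2 := by linear_combination hq
    have h' : (-3 * w ^ 2) ^ 3 = -27 := by
      linear_combination (-27) * (w ^ 3 + 1) * h1
    rw [h, pow_mul, h']
    simp
  rw [hr, Complex.ofReal_im] at key
  simp only [Complex.im_sum, Complex.im_ofReal_mul, omega_im w h1 h2] at key
  rw [← sub_eq_zero]
  apply mul_left_cancel₀ him
  rw [mul_zero]
  refine Eq.trans ?_ key
  rw [← Finset.sum_sub_distrib, Finset.mul_sum]
  refine Finset.sum_congr rfl fun p _ => ?_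
  rw [← Finset.sum_sub_distrib, Finset.mul_sum]
  refine Finset.sum_congr rfl fun q _ => ?_
  split_ifs <;> ring
end

section
/- For every positive integer m, Σ {2^q · (−3)^p · C(m,p) · C(m−p,q) : 0 ≤ p ≤ m, 0 ≤ q ≤ m−p, 2p + q ≡ 0 (mod 3)} = Σ {2^p · (−3)^q · C(m,p) · C(m−p,q) : 0 ≤ p ≤ m, 0 ≤ q ≤ m−p, 2p + q ≡ 0 (mod 3)}. -/
lemma choose_swap_aux (m p q : ℕ) (hp : p ≤ m) (hq : q ≤ m) :
    m.choose p * (m - p).choose q = m.choose q * (m - q).choose p := by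
  by_cases h : p + q ≤ m
  · have h1 := @Nat.choose_mul m (p + q) p (by omega)
    have h2 := @Nat.choose_mul m (p + q) q (by omega)
    rw [Nat.add_sub_cancel_left] at h1
    rw [Nat.add_sub_cancel] at h2
    rw [← h1, ← h2, Nat.choose_symm_add]
  · rw [Nat.choose_eq_zero_of_lt (show m - p < q by omega),
      Nat.choose_eq_zero_of_lt (show m - q < p by omega)]
    simp

lemma extend_range_aux (m : ℕ) (f : ℕ → ℕ → ℝ) :
    (∑ p ∈ Finset.range (m + 1), ∑ q ∈ Finset.range (m - p + 1),
      (if (2 * p + q) % 3 = 0 then f p q * (m.choose p) * ((m - p).choose q) else 0)) =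
    ∑ p ∈ Finset.range (m + 1), ∑ q ∈ Finset.range (m + 1),
      (if (2 * p + q) % 3 = 0 then f p q * (m.choose p) * ((m - p).choose q) else 0) := by
  refine Finset.sum_congr rfl fun p _ => ?_
  refine Finset.sum_subset (fun q hq => ?_) fun q _ hq => ?_
  · simp only [Finset.mem_range] at *; omega
  · simp only [Finset.mem_range] at hq
    rw [Nat.choose_eq_zero_of_lt (show m - p < q by omega)]
    simp


/-- For every positive `m`, the double binomial sums with weights `2^q (−3)^p` and
`2^p (−3)^q` over `2p + q ≡ 0 (mod 3)` coincide. -/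
theorem double_binom_sum_swap (m : ℕ) (hm : 0 < m) :
    (∑ p ∈ Finset.range (m + 1), ∑ q ∈ Finset.range (m - p + 1),
      (if (2 * p + q) % 3 = 0 then
        (2 : ℝ) ^ q * (-3 : ℝ) ^ p * (m.choose p) * ((m - p).choose q) else 0)) =
    (∑ p ∈ Finset.range (m + 1), ∑ q ∈ Finset.range (m - p + 1),
      (if (2 * p + q) % 3 = 0 then
        (2 : ℝ) ^ p * (-3 : ℝ) ^ q * (m.choose p) * ((m - p).choose q) else 0)) := by
  rw [extend_range_aux m (fun p q => (2 : ℝ) ^ q * (-3 : ℝ) ^ p),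
    extend_range_aux m (fun p q => (2 : ℝ) ^ p * (-3 : ℝ) ^ q), Finset.sum_comm]
  refine Finset.sum_congr rfl fun q hq => Finset.sum_congr rfl fun p hp => ?_
  simp only [Finset.mem_range] at hp hq
  have h : ((m.choose p : ℝ)) * ((m - p).choose q) = m.choose q * ((m - q).choose p) := by
    exact_mod_cast choose_swap_aux m p q (by omega) (by omega)
  have hc : (2 * p + q) % 3 = 0 ↔ (2 * q + p) % 3 = 0 := by omega
  simp only [hc, mul_assoc, h]
end

section
/- Suppose the m-th order n-dimensional Hankel tensor generated by v is a generalized anti-circulant tensor with circulant index 2, where m = 2k ≥ 2 and n ≥ 2. Then the tensor is PSD if and only if |v_1| ≤ v_0. Moreover, if |v_1| ≤ v_0 and we write v_1 = v_0·(2t − 1) with t ∈ [0,1], then f(x) = t·v_0·(x_1 + ⋯ + x_n)^m + (1 − t)·v_0·(x_1 − x_2 + x_3 − ⋯ + (−1)^{n−1}·x_n)^m for all x ∈ ℝ^n. -/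
theorem anticirc_val (N : ℕ) (v : ℕ → ℝ) (hac : ∀ i, i + 2 ≤ N → v (i + 2) = v i) (s : ℕ)
    (hs : s ≤ N) : v s = (v 0 + v 1) / 2 + (v 0 - v 1) / 2 * (-1) ^ s := by
  induction s using Nat.strong_induction_on with
  | _ s ih =>
    match s, ih, hs with
    | 0, _, _ => norm_num; ring
    | 1, _, _ => norm_num; ring
    | s + 2, ih, hs =>
      rw [hac s hs, ih s (by omega) (by omega), pow_add]
      norm_num

theorem anticirc_poly (m n : ℕ) (v : ℕ → ℝ)
    (hac : ∀ i, i + 2 ≤ (n - 1) * m → v (i + 2) = v i) (x : Fin n → ℝ) :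
    hankelPoly m n v x = (v 0 + v 1) / 2 * (∑ i, x i) ^ m
      + (v 0 - v 1) / 2 * (∑ i : Fin n, (-1 : ℝ) ^ (i : ℕ) * x i) ^ m := by
  unfold hankelPoly
  rw [Fintype.sum_pow, Fintype.sum_pow, Finset.mul_sum, Finset.mul_sum, ← Finset.sum_add_distrib]
  refine Finset.sum_congr rfl fun i _ => ?_
  have hs : ∑ j, (i j : ℕ) ≤ (n - 1) * m := by
    calc ∑ j, (i j : ℕ) ≤ ∑ _j : Fin m, (n - 1) :=
          Finset.sum_le_sum fun j _ => by have := (i j).isLt; omega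
      _ = (n - 1) * m := by simp [mul_comm]
  rw [anticirc_val _ v hac _ hs, Finset.prod_mul_distrib, Finset.prod_pow_eq_pow_sum]
  ring

/-- Circulant index 2 case: the tensor is PSD iff `|v₁| ≤ v₀`; and writing
`v₁ = v₀ (2t − 1)` with `t ∈ [0,1]`, the Hankel polynomial is
`t v₀ (x₁ + ⋯ + x_n)^m + (1 − t) v₀ (x₁ − x₂ + ⋯ + (−1)^{n−1} x_n)^m`. -/
theorem anticirculant_index_two (m n k : ℕ) (hm : m = 2 * k) (hk : 1 ≤ k) (hn : 2 ≤ n)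
    (v : ℕ → ℝ) (hac : ∀ i, i + 2 ≤ (n - 1) * m → v (i + 2) = v i) :
    ((∀ x : Fin n → ℝ, 0 ≤ hankelPoly m n v x) ↔ |v 1| ≤ v 0) ∧
    (|v 1| ≤ v 0 → ∀ t : ℝ, t ∈ Set.Icc (0 : ℝ) 1 → v 1 = v 0 * (2 * t - 1) →
      ∀ x : Fin n → ℝ, hankelPoly m n v x =
        t * v 0 * (∑ i, x i) ^ m + (1 - t) * v 0 * (∑ i : Fin n, (-1 : ℝ) ^ (i : ℕ) * x i) ^ m) := by
  have hP := anticirc_poly m n v hac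
  have hme : Even m := by rw [hm]; exact even_two_mul k
  have hm0 : m ≠ 0 := by omega
  refine ⟨⟨fun h => ?_, fun h x => ?_⟩, fun _ t _ ht x => ?_⟩
  · obtain ⟨n, rfl⟩ : ∃ p, n = p + 2 := ⟨n - 2, by omega⟩
    have h2 : (0 : ℝ) < 2 ^ m := by positivity
    have h1 := h (Fin.cons 1 (Fin.cons 1 fun _ => 0))
    have h3 := h (Fin.cons 1 (Fin.cons (-1) fun _ => 0))
    rw [hP] at h1 h3
    simp [Fin.sum_univ_succ, hm0] at h1 h3
    have e1 : 0 ≤ (v 0 + v 1) / 2 := by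
      by_contra hc
      nlinarith
    have e3 : 0 ≤ (v 0 - v 1) / 2 := by
      by_contra hc
      nlinarith
    rw [abs_le]
    constructor <;> linarith
  · rw [hP]
    rw [abs_le] at h
    have e1 : 0 ≤ (v 0 + v 1) / 2 := by linarith
    have e3 : 0 ≤ (v 0 - v 1) / 2 := by linarith
    exact add_nonneg (mul_nonneg e1 (hme.pow_nonneg _)) (mul_nonneg e3 (hme.pow_nonneg _))
  · rw [hP, ht]
    ring
end

section
/- Suppose the m-th order n-dimensional Hankel tensor generated by v is a generalized anti-circulant tensor with circulant index 2, where m = 2k ≥ 2 and n ≥ 2. Then its Hankel polynomial satisfies f(x) = ((v_0 + v_1)/2)·(x_1 + ⋯ + x_n)^m + ((v_0 − v_1)/2)·(x_1 − x_2 + x_3 − ⋯ + (−1)^{n−1}·x_n)^m for all x ∈ ℝ^n. -/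
/-- Circulant index 2 case: the Hankel polynomial equals
`((v₀+v₁)/2) (x₁ + ⋯ + x_n)^m + ((v₀−v₁)/2) (x₁ − x₂ + ⋯ + (−1)^{n−1} x_n)^m`. -/
theorem anticirculant_index_two_decomp (m n k : ℕ) (hm : m = 2 * k) (hk : 1 ≤ k) (hn : 2 ≤ n)
    (v : ℕ → ℝ) (hac : ∀ i, i + 2 ≤ (n - 1) * m → v (i + 2) = v i) :
    ∀ x : Fin n → ℝ, hankelPoly m n v x =
      ((v 0 + v 1) / 2) * (∑ i, x i) ^ m +
      ((v 0 - v 1) / 2) * (∑ i : Fin n, (-1 : ℝ) ^ (i : ℕ) * x i) ^ m := by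
  intro x
  have hv : ∀ s, s ≤ (n - 1) * m →
      v s = (v 0 + v 1) / 2 + (v 0 - v 1) / 2 * (-1 : ℝ) ^ s := by
    intro s
    induction s using Nat.strong_induction_on with
    | _ s ih =>
      intro hs
      match s, ih, hs with
      | 0, _, _ => ring
      | 1, _, _ => ring
      | t + 2, ih, hs =>
        rw [hac t hs, ih t (by omega) (by omega)]
        ring
  have hb : ∀ i : Fin m → Fin n, ∑ j, (i j : ℕ) ≤ (n - 1) * m := by
    intro i
    calc ∑ j, (i j : ℕ) ≤ ∑ _j : Fin m, (n - 1) :=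
          Finset.sum_le_sum fun j _ => by have := (i j).isLt; omega
      _ = (n - 1) * m := by simp [mul_comm]
  have hp : ∀ g : Fin n → ℝ, (∑ i, g i) ^ m = ∑ i : Fin m → Fin n, ∏ j, g (i j) := by
    intro g
    have h := Finset.prod_univ_sum (fun _ : Fin m => (Finset.univ : Finset (Fin n)))
      (fun _ a => g a)
    simpa using h
  rw [hp, hp, Finset.mul_sum, Finset.mul_sum, ← Finset.sum_add_distrib, hankelPoly]
  refine Finset.sum_congr rfl fun i _ => ?_
  rw [hv _ (hb i), Finset.prod_mul_distrib, Finset.prod_pow_eq_pow_sum]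
  ring
end

section
/- Let m = 2k with k ≥ 1, let r = 2p be an even integer with 4 ≤ r ≤ 2n−4, and suppose GCD(m, r) = 2. Suppose the m-th order n-dimensional Hankel tensor generated by v satisfies v_i = v_{i+r} for all i = 0,…,(n−1)m−r. Then the tensor is PSD if and only if v_0 = v_2 = ⋯ = v_{r−2}, v_1 = v_3 = ⋯ = v_{r−1}, and v_0 ≥ |v_1|. Moreover, if these conditions hold and we write v_1 = v_0·(2t − 1) with t ∈ [0,1], then f(x) = t·v_0·(x_1 + ⋯ + x_n)^m + (1 − t)·v_0·(x_1 − x_2 + x_3 − ⋯ + (−1)^{n−1}·x_n)^m for all x ∈ ℝ^n, and the associated Hankel matrix is positive semidefinite (i.e., the tensor is a strong Hankel tensor). -/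
/-- The linear functional sending `X ^ j` to `w j`. -/
noncomputable def momentL (w : ℕ → ℝ) : Polynomial ℝ →ₗ[ℝ] ℝ :=
  (Polynomial.basisMonomials ℝ).constr ℝ w

theorem momentL_monomial (w : ℕ → ℝ) (j : ℕ) (a : ℝ) :
    momentL w (Polynomial.monomial j a) = a * w j := by
  have h : Polynomial.monomial j a = a • (Polynomial.basisMonomials ℝ) j := by
    simp [Polynomial.smul_monomial]
  rw [h, map_smul, momentL, Module.Basis.constr_basis, smul_eq_mul]

theorem momentL_X_pow (w : ℕ → ℝ) (j : ℕ) : momentL w (Polynomial.X ^ j) = w j := by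
  rw [Polynomial.X_pow_eq_monomial, momentL_monomial, one_mul]

theorem hankelPoly_eq_momentL (m n : ℕ) (w : ℕ → ℝ) (x : Fin n → ℝ) :
    hankelPoly m n w x =
      momentL w ((∑ i : Fin n, Polynomial.monomial (i : ℕ) (x i)) ^ m) := by
  rw [Fintype.sum_pow, map_sum, hankelPoly]
  refine Finset.sum_congr rfl fun i _ => ?_
  have : ∏ j, Polynomial.monomial (i j : ℕ) (x (i j)) =
      Polynomial.monomial (∑ j, (i j : ℕ)) (∏ j, x (i j)) := by
    simp only [← Polynomial.C_mul_X_pow_eq_monomial]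
    rw [Finset.prod_mul_distrib, Finset.prod_pow_eq_pow_sum, map_prod]
  rw [this, momentL_monomial, mul_comm]

theorem sum_index_le (m n : ℕ) (i : Fin m → Fin n) : ∑ j, (i j : ℕ) ≤ (n - 1) * m := by
  calc ∑ j, (i j : ℕ) ≤ ∑ _j : Fin m, (n - 1) :=
        Finset.sum_le_sum fun j _ => by have := (i j).2; omega
    _ = (n - 1) * m := by simp [mul_comm]

theorem hankelPoly_congr (m n : ℕ) (v w : ℕ → ℝ) (h : ∀ j ≤ (n - 1) * m, v j = w j)
    (x : Fin n → ℝ) : hankelPoly m n v x = hankelPoly m n w x := by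
  refine Finset.sum_congr rfl fun i _ => ?_
  rw [h _ (sum_index_le m n i)]

theorem hankelPoly_two (m n : ℕ) (v : ℕ → ℝ) (A B : ℝ)
    (h : ∀ j ≤ (n - 1) * m, v j = A + B * (-1) ^ j) (x : Fin n → ℝ) :
    hankelPoly m n v x =
      A * (∑ i, x i) ^ m + B * (∑ i : Fin n, (-1 : ℝ) ^ (i : ℕ) * x i) ^ m := by
  rw [Fintype.sum_pow, Fintype.sum_pow, Finset.mul_sum, Finset.mul_sum,
    ← Finset.sum_add_distrib]
  refine Finset.sum_congr rfl fun i _ => ?_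
  rw [h _ (sum_index_le m n i), Finset.prod_mul_distrib, Finset.prod_pow_eq_pow_sum]
  ring

theorem momentL_nonneg (m n : ℕ) (w : ℕ → ℝ) (h : ∀ x : Fin n → ℝ, 0 ≤ hankelPoly m n w x)
    (Q : Polynomial ℝ) (hQ : Q.natDegree < n) : 0 ≤ momentL w (Q ^ m) := by
  have := h fun i => Q.coeff i
  rw [hankelPoly_eq_momentL,
    Fin.sum_univ_eq_sum_range (fun i => Polynomial.monomial i (Q.coeff i)) n,
    ← Polynomial.as_sum_range' Q n hQ] at this
  exact this

theorem momentL_periodic (w : ℕ → ℝ) (r : ℕ) (hw : ∀ j, w (j + r) = w j) (Q : Polynomial ℝ) :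
    momentL w (Polynomial.X ^ r * Q) = momentL w Q := by
  induction Q using Polynomial.induction_on' with
  | add p q hp hq => rw [mul_add, map_add, map_add, hp, hq]
  | monomial j a =>
    rw [Polynomial.X_pow_mul_monomial, momentL_monomial, momentL_monomial, hw]

theorem periodic_mul (T : ℕ → ℝ) (r : ℕ) (hT : ∀ j, T (j + r) = T j) (b j : ℕ) :
    T (j + b * r) = T j := by
  induction b with
  | zero => simp
  | succ b ih => rw [← ih, ← hT (j + b * r)]; congr 1; ring

theorem bezout_two (m r : ℕ) (hr4 : 4 ≤ r) (hgcd : Nat.gcd m r = 2) :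
    ∃ a b : ℕ, a * m = 2 + b * r := by
  obtain ⟨a, _, ha⟩ := Nat.exists_mul_mod_eq_gcd (n := m) (k := r) (by omega)
  refine ⟨a, m * a / r, ?_⟩
  have := Nat.mod_add_div (m * a) r
  rw [ha, hgcd] at this
  linarith [mul_comm (m * a / r) r]

/-- A nonnegative polynomial function vanishing at zero has vanishing linear coefficient. -/
theorem linear_coeff_zero (G : Polynomial ℝ) (h : ∀ e : ℝ, 0 ≤ G.eval e) (h0 : G.eval 0 = 0) :
    G.coeff 1 = 0 := by
  have hmin : IsLocalMin (fun e => G.eval e) 0 :=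
    Filter.Eventually.of_forall fun e => by simpa [h0] using h e
  have h1 := hmin.deriv_eq_zero
  rw [Polynomial.deriv, ← Polynomial.coeff_zero_eq_eval_zero, Polynomial.coeff_derivative] at h1
  simpa using h1

theorem first_order (L : Polynomial ℝ →ₗ[ℝ] ℝ) (m : ℕ) (hm : 1 ≤ m) (Y q g : Polynomial ℝ)
    (h : ∀ e : ℝ, 0 ≤ L (Y * (Polynomial.C e * g + q) ^ m)) (h0 : L (Y * q ^ m) = 0) :
    L (Y * (g * q ^ (m - 1))) = 0 := by
  set G : Polynomial ℝ := ∑ i ∈ Finset.range (m + 1),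
    Polynomial.monomial i (L (Y * (g ^ i * q ^ (m - i))) * (m.choose i : ℝ)) with hG
  have hev : ∀ e : ℝ, G.eval e = L (Y * (Polynomial.C e * g + q) ^ m) := by
    intro e
    rw [add_pow, Finset.mul_sum, map_sum, hG, Polynomial.eval_finsetSum]
    refine Finset.sum_congr rfl fun i _ => ?_
    have : Y * ((Polynomial.C e * g) ^ i * q ^ (m - i) * (m.choose i : Polynomial ℝ)) =
        (e ^ i * (m.choose i : ℝ)) • (Y * (g ^ i * q ^ (m - i))) := by
      rw [Polynomial.smul_eq_C_mul, map_mul, map_pow, Polynomial.C_eq_natCast]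
      ring
    rw [this, map_smul, Polynomial.eval_monomial, smul_eq_mul]
    ring
  have hc := linear_coeff_zero G (fun e => by rw [hev]; exact h e) (by rw [hev]; simpa using h0)
  rw [hG, Polynomial.finsetSum_coeff, Finset.sum_eq_single 1] at hc
  · rw [Polynomial.coeff_monomial_same] at hc
    rcases mul_eq_zero.1 hc with hc | hc
    · simpa using hc
    · rw [Nat.choose_one_right] at hc
      have : m = 0 := by exact_mod_cast hc
      omega
  · intro i _ hi
    rw [Polynomial.coeff_monomial_of_ne _ hi.symm]
  · intro hi
    simp at hi
    omega

theorem descend (L : Polynomial ℝ →ₗ[ℝ] ℝ) (p : ℕ) (hp : 1 ≤ p)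
    (hL : ∀ Q, L (Polynomial.X ^ (2 * p) * Q) = L Q) (b : ℕ)
    (h : ∀ j, L (Polynomial.X ^ j * (Polynomial.X ^ 2 - 1) ^ (b + 1)) = 0) :
    ∀ j, L (Polynomial.X ^ j * (Polynomial.X ^ 2 - 1) ^ 1) = 0 := by
  induction b with
  | zero => exact h
  | succ b ih =>
    apply ih
    have step : ∀ c j, L (Polynomial.X ^ j * (Polynomial.X ^ 2 - 1) ^ (c + 1)) =
        L (Polynomial.X ^ (j + 2) * (Polynomial.X ^ 2 - 1) ^ c) -
          L (Polynomial.X ^ j * (Polynomial.X ^ 2 - 1) ^ c) := by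
      intro c j
      rw [← map_sub]
      congr 1
      ring
    intro j
    have key : ∀ i : ℕ,
        L (Polynomial.X ^ (j + 2 * i) * (Polynomial.X ^ 2 - 1) ^ (b + 1)) =
          L (Polynomial.X ^ j * (Polynomial.X ^ 2 - 1) ^ (b + 1)) ∧
        L (Polynomial.X ^ (j + 2 * i) * (Polynomial.X ^ 2 - 1) ^ b) =
          L (Polynomial.X ^ j * (Polynomial.X ^ 2 - 1) ^ b) +
            i * L (Polynomial.X ^ j * (Polynomial.X ^ 2 - 1) ^ (b + 1)) := by
      intro i
      induction i with
      | zero => simp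
      | succ i ihi =>
        have h1 := h (j + 2 * i)
        rw [step (b + 1)] at h1
        have h2 := step b (j + 2 * i)
        rw [show j + 2 * (i + 1) = j + 2 * i + 2 by ring]
        obtain ⟨h3, h4⟩ := ihi
        constructor
        · linarith
        · push_cast
          linarith
    have h5 := (key p).2
    rw [show j + 2 * p = 2 * p + j by ring, pow_add, mul_assoc, hL] at h5
    have h6 : (p : ℝ) * L (Polynomial.X ^ j * (Polynomial.X ^ 2 - 1) ^ (b + 1)) = 0 := by
      linarith
    rcases mul_eq_zero.1 h6 with h7 | h7
    · have : p = 0 := by exact_mod_cast h7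
      omega
    · exact h7

theorem two_periodic (m n k p r : ℕ) (hm : m = 2 * k) (hk : 1 ≤ k)
    (hr : r = 2 * p) (hr4 : 4 ≤ r) (hrn : r ≤ 2 * n - 4) (hgcd : Nat.gcd m r = 2)
    (w : ℕ → ℝ) (hw : ∀ j, w (j + r) = w j)
    (h : ∀ x : Fin n → ℝ, 0 ≤ hankelPoly m n w x) (j : ℕ) : w (j + 2) = w j := by
  obtain ⟨a, b, hab⟩ := bezout_two m r hr4 hgcd
  have hpm : p * m = k * r := by rw [hm, hr]; ring
  set q : Polynomial ℝ := Polynomial.X ^ 2 - 1 with hq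
  -- the averaged sequence is 2-periodic
  have hS : ∀ t, ∑ i ∈ Finset.range p, w (t + 2 + i * m) =
      ∑ i ∈ Finset.range p, w (t + i * m) := by
    have hSr : ∀ t, (fun t => ∑ i ∈ Finset.range p, w (t + i * m)) (t + r) =
        (fun t => ∑ i ∈ Finset.range p, w (t + i * m)) t := by
      intro t
      refine Finset.sum_congr rfl fun i _ => ?_
      rw [← hw (t + i * m)]; congr 1; ring
    have hSm : ∀ t, (fun t => ∑ i ∈ Finset.range p, w (t + i * m)) (t + m) =
        (fun t => ∑ i ∈ Finset.range p, w (t + i * m)) t := by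
      intro t
      have h1 := Finset.sum_range_succ (fun i => w (t + i * m)) p
      have h2 := Finset.sum_range_succ' (fun i => w (t + i * m)) p
      have h3 : w (t + p * m) = w (t + 0 * m) := by
        rw [hpm, periodic_mul w r hw]; simp
      have h4 : ∑ i ∈ Finset.range p, w (t + m + i * m) =
          ∑ i ∈ Finset.range p, w (t + (i + 1) * m) :=
        Finset.sum_congr rfl fun i _ => by congr 1; ring
      simp only
      linarith
    intro t
    have h1 := periodic_mul (fun t => ∑ i ∈ Finset.range p, w (t + i * m)) r hSr b (t + 2)
    have h2 := periodic_mul (fun t => ∑ i ∈ Finset.range p, w (t + i * m)) m hSm a t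
    rw [hab, ← add_assoc, h1] at h2
    exact h2
  have hSL : ∀ Q, ∑ i ∈ Finset.range p, momentL w (Polynomial.X ^ (i * m) * (q * Q)) = 0 := by
    intro Q
    induction Q using Polynomial.induction_on' with
    | add P Q hP hQ =>
      simp only [mul_add, map_add, Finset.sum_add_distrib, hP, hQ, add_zero]
    | monomial t c =>
      have : ∀ i, momentL w (Polynomial.X ^ (i * m) * (q * Polynomial.monomial t c)) =
          c * (w (t + 2 + i * m) - w (t + i * m)) := by
        intro i
        rw [hq, sub_mul, one_mul, mul_sub, map_sub, Polynomial.X_pow_mul_monomial,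
          Polynomial.X_pow_mul_monomial, Polynomial.X_pow_mul_monomial,
          momentL_monomial, momentL_monomial]
        ring
      simp only [this]
      rw [← Finset.mul_sum, Finset.sum_sub_distrib, hS, sub_self, mul_zero]
  -- nonnegativity for quadratic polynomials
  have hF : ∀ i < p, ∀ Q : Polynomial ℝ, Q.natDegree ≤ 2 →
      0 ≤ momentL w (Polynomial.X ^ (i * m) * Q ^ m) := by
    intro i hi Q hQ
    rw [pow_mul, ← mul_pow]
    refine momentL_nonneg m n w h _ ?_
    refine lt_of_le_of_lt Polynomial.natDegree_mul_le ?_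
    rw [Polynomial.natDegree_X_pow]
    omega
  have hqd : q.natDegree ≤ 2 := by rw [hq]; compute_degree
  have hF0 : ∀ i < p, momentL w (Polynomial.X ^ (i * m) * q ^ m) = 0 := by
    have h1 := hSL (q ^ (m - 1))
    rw [← pow_succ', show m - 1 + 1 = m by omega] at h1
    rw [Finset.sum_eq_zero_iff_of_nonneg
      (fun i hi => hF i (Finset.mem_range.1 hi) q hqd)] at h1
    exact fun i hi => h1 i (Finset.mem_range.2 hi)
  have hgrad : ∀ i < p, ∀ g : Polynomial ℝ, g.natDegree ≤ 2 →
      momentL w (Polynomial.X ^ (i * m) * (g * q ^ (m - 1))) = 0 := by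
    intro i hi g hg
    refine first_order (momentL w) m (by omega) _ q g (fun e => hF i hi _ ?_) (hF0 i hi)
    refine Polynomial.natDegree_add_le_of_degree_le ?_ hqd
    exact (Polynomial.natDegree_C_mul_le _ _).trans hg
  have hall : ∀ g : Polynomial ℝ, g.natDegree ≤ 2 → ∀ e,
      momentL w (Polynomial.X ^ (2 * e) * (g * q ^ (m - 1))) = 0 := by
    intro g hg e
    have hT : ∀ j, (fun j => momentL w (Polynomial.X ^ j * (g * q ^ (m - 1)))) (j + r) =
        (fun j => momentL w (Polynomial.X ^ j * (g * q ^ (m - 1)))) j := by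
      intro j
      simp only
      rw [add_comm, pow_add, mul_assoc, momentL_periodic w r hw]
    have h1 := periodic_mul
      (fun j => momentL w (Polynomial.X ^ j * (g * q ^ (m - 1)))) r hT (e * b) (2 * e)
    have h2 := periodic_mul
      (fun j => momentL w (Polynomial.X ^ j * (g * q ^ (m - 1)))) r hT ((e * a) / p * k) ((e * a) % p * m)
    have h3 := Nat.mod_add_div (e * a) p
    have h4 : 2 * e + e * b * r = (e * a) % p * m + (e * a) / p * k * r := by
      calc 2 * e + e * b * r = e * (2 + b * r) := by ring
        _ = (e * a) * m := by rw [← hab]; ring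
        _ = ((e * a) % p + p * ((e * a) / p)) * m := by rw [h3]
        _ = (e * a) % p * m + (e * a) / p * (p * m) := by ring
        _ = _ := by rw [hpm]; ring
    rw [h4, h2] at h1
    rw [← h1]
    exact hgrad _ (Nat.mod_lt _ (by omega)) g hg
  have hall' : ∀ j, momentL w (Polynomial.X ^ j * q ^ (m - 2 + 1)) = 0 := by
    intro j
    rw [show m - 2 + 1 = m - 1 by omega]
    obtain ⟨e, he | he⟩ := Nat.even_or_odd' j
    · have := hall 1 (by simp) e
      rwa [one_mul, ← he] at this
    · have := hall Polynomial.X (by simp) e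
      rwa [← mul_assoc, ← pow_succ, ← he] at this
  have hfin := descend (momentL w) p (by omega)
    (fun Q => by rw [← hr]; exact momentL_periodic w r hw Q) (m - 2) hall' j
  rw [pow_one, mul_sub, mul_one, ← pow_add, map_sub, momentL_X_pow, momentL_X_pow] at hfin
  linarith

theorem two_values (N p r : ℕ) (hr : r = 2 * p) (hr4 : 4 ≤ r) (v : ℕ → ℝ)
    (hv : ∀ j ≤ N, v j = v (j % r)) (he : ∀ i < p, v (2 * i) = v 0)
    (ho : ∀ i < p, v (2 * i + 1) = v 1) (j : ℕ) (hj : j ≤ N) :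
    v j = (v 0 + v 1) / 2 + (v 0 - v 1) / 2 * (-1) ^ j := by
  rw [hv j hj]
  have hlt := Nat.mod_lt j (show 0 < r by omega)
  have hpar : j % r % 2 = j % 2 := Nat.mod_mod_of_dvd j ⟨p, hr⟩
  rcases Nat.even_or_odd j with hp | hp
  · rw [hp.neg_one_pow]
    have := Nat.even_iff.1 hp
    rw [show j % r = 2 * (j % r / 2) by omega, he _ (by omega)]
    ring
  · rw [hp.neg_one_pow]
    have := Nat.odd_iff.1 hp
    rw [show j % r = 2 * (j % r / 2) + 1 by omega, ho _ (by omega)]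
    ring

/-- The case `GCD(m, r) = 2` with `r = 2p`, `4 ≤ r ≤ 2n − 4`: the tensor is PSD iff
`v₀ = v₂ = ⋯ = v_{r−2}`, `v₁ = v₃ = ⋯ = v_{r−1}` and `v₀ ≥ |v₁|`; in this case,
writing `v₁ = v₀ (2t − 1)` with `t ∈ [0,1]`, the Hankel polynomial is
`t v₀ (x₁ + ⋯ + x_n)^m + (1 − t) v₀ (x₁ − x₂ + ⋯ + (−1)^{n−1} x_n)^m`, and the
associated Hankel matrix is positive semidefinite (strong Hankel tensor). -/
theorem anticirculant_gcd_two (m n k p r : ℕ) (hm : m = 2 * k) (hk : 1 ≤ k) (hn : 2 ≤ n)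
    (hr : r = 2 * p) (hr4 : 4 ≤ r) (hrn : r ≤ 2 * n - 4) (hgcd : Nat.gcd m r = 2)
    (v : ℕ → ℝ) (hac : ∀ i, i + r ≤ (n - 1) * m → v (i + r) = v i) :
    ((∀ x : Fin n → ℝ, 0 ≤ hankelPoly m n v x) ↔
      ((∀ i < p, v (2 * i) = v 0) ∧ (∀ i < p, v (2 * i + 1) = v 1) ∧ |v 1| ≤ v 0)) ∧
    (((∀ i < p, v (2 * i) = v 0) ∧ (∀ i < p, v (2 * i + 1) = v 1) ∧ |v 1| ≤ v 0) →
      ∀ t : ℝ, t ∈ Set.Icc (0 : ℝ) 1 → v 1 = v 0 * (2 * t - 1) →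
        (∀ x : Fin n → ℝ, hankelPoly m n v x =
          t * v 0 * (∑ i, x i) ^ m + (1 - t) * v 0 * (∑ i : Fin n, (-1 : ℝ) ^ (i : ℕ) * x i) ^ m) ∧
        (hankelMatrix (n * k - k + 1) v).PosSemidef) := by
  have hn4 : 4 ≤ n := by omega
  have hmod : ∀ j ≤ (n - 1) * m, v j = v (j % r) := by
    intro j
    induction j using Nat.strong_induction_on with
    | _ j ih =>
      intro hj
      by_cases hjr : j < r
      · rw [Nat.mod_eq_of_lt hjr]
      · have h1 := hac (j - r) (by omega)
        have h2 := ih (j - r) (by omega) (by omega)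
        rw [show j - r + r = j by omega] at h1
        rw [h1, h2, ← Nat.mod_eq_sub_mod (by omega)]
  have hbig : n ≤ (n - 1) * m := by
    have : (n - 1) * 2 ≤ (n - 1) * m := Nat.mul_le_mul_left _ (by omega)
    omega
  have heven : Even m := ⟨k, by omega⟩
  refine ⟨⟨fun h => ?_, ?_⟩, ?_⟩
  · have hper := two_periodic m n k p r hm hk hr hr4 hrn hgcd (fun j => v (j % r))
      (fun j => by simp) (fun x => by
        rw [← hankelPoly_congr m n v (fun j => v (j % r)) hmod]; exact h x)
    have h2 : ∀ c, c < r → ∀ i, c + i * 2 < r → v (c + i * 2) = v c := by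
      intro c hc i hi
      have := periodic_mul (fun j => v (j % r)) 2 hper i c
      rwa [Nat.mod_eq_of_lt hi, Nat.mod_eq_of_lt hc] at this
    have he : ∀ i < p, v (2 * i) = v 0 := fun i hi => by
      have := h2 0 (by omega) i (by omega)
      rwa [zero_add, mul_comm] at this
    have ho : ∀ i < p, v (2 * i + 1) = v 1 := fun i hi => by
      have := h2 1 (by omega) i (by omega)
      rwa [add_comm, mul_comm] at this
    refine ⟨he, ho, ?_⟩
    have hform := hankelPoly_two m n v _ _ (two_values _ p r hr hr4 v hmod he ho)
    obtain ⟨l, rfl⟩ : ∃ l, n = l + 2 := ⟨n - 2, by omega⟩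
    have h2m : (0 : ℝ) < 2 ^ m := by positivity
    have hA := h (Fin.cons 1 (Fin.cons 1 0))
    have hB := h (Fin.cons 1 (Fin.cons (-1) 0))
    rw [hform] at hA hB
    simp [Fin.sum_univ_succ] at hA hB
    have hm0 : m ≠ 0 := by omega
    norm_num [hm0] at hA hB
    have hA' := nonneg_of_mul_nonneg_left hA (by positivity)
    have hB' := nonneg_of_mul_nonneg_left hB (by positivity)
    rw [abs_le]
    constructor <;> linarith
  · rintro ⟨he, ho, hab⟩ x
    rw [hankelPoly_two m n v _ _ (two_values _ p r hr hr4 v hmod he ho)]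
    rw [abs_le] at hab
    have h1 := heven.pow_nonneg (∑ i, x i)
    have h2 := heven.pow_nonneg (∑ i : Fin n, (-1 : ℝ) ^ (i : ℕ) * x i)
    have h3 : 0 ≤ (v 0 + v 1) / 2 := by linarith
    have h4 : 0 ≤ (v 0 - v 1) / 2 := by linarith
    positivity
  · rintro ⟨he, ho, hab⟩ t ⟨ht0, ht1⟩ ht
    have hval := two_values _ p r hr hr4 v hmod he ho
    have hA : (v 0 + v 1) / 2 = t * v 0 := by rw [ht]; ring
    have hB : (v 0 - v 1) / 2 = (1 - t) * v 0 := by rw [ht]; ring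
    have hv0 : 0 ≤ v 0 := (abs_nonneg _).trans hab
    rw [hA, hB] at hval
    refine ⟨hankelPoly_two m n v _ _ hval, ?_⟩
    have hM : hankelMatrix (n * k - k + 1) v =
        (t * v 0) • Matrix.vecMulVec (fun _ => (1 : ℝ)) (star fun _ => (1 : ℝ)) +
        ((1 - t) * v 0) • Matrix.vecMulVec
          (fun i : Fin (n * k - k + 1) => (-1 : ℝ) ^ (i : ℕ))
          (star fun i : Fin (n * k - k + 1) => (-1 : ℝ) ^ (i : ℕ)) := by
      ext i j
      have hN : (n - 1) * m = 2 * (n * k - k) := by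
        rw [hm, ← Nat.sub_one_mul]; ring
      have hi := i.2
      have hj := j.2
      simp only [hankelMatrix, Matrix.of_apply, Matrix.add_apply, Matrix.smul_apply,
        Matrix.vecMulVec_apply, star_trivial, smul_eq_mul]
      rw [hval _ (by omega), pow_add]
      ring
    rw [hM]
    exact ((Matrix.posSemidef_vecMulVec_self_star _).smul (mul_nonneg ht0 hv0)).add
      ((Matrix.posSemidef_vecMulVec_self_star _).smul (mul_nonneg (by linarith) hv0))
end

section
/- Suppose the fourth order n-dimensional Hankel tensor generated by v is a generalized anti-circulant tensor with circulant index 4, where n ≥ 4. Then the tensor is PSD if and only if v_0 = v_2, v_1 = v_3, and |v_1| ≤ v_0. Moreover, if these conditions hold and we write v_1 = v_0·(2t − 1) with t ∈ [0,1], then f(x) = t·v_0·(x_1 + ⋯ + x_n)^4 + (1 − t)·v_0·(x_1 − x_2 + x_3 − ⋯ + (−1)^{n−1}·x_n)^4 for all x ∈ ℝ^n, and the associated Hankel matrix is positive semidefinite (i.e., the tensor is a strong Hankel tensor). -/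
lemma hankel_geom {R : Type*} [CommSemiring R] (m n : ℕ) (z : R) (x : Fin n → R) :
    ∑ i : Fin m → Fin n, z ^ (∑ j, (i j : ℕ)) * ∏ j, x (i j)
      = (∑ i : Fin n, z ^ (i : ℕ) * x i) ^ m := by
  rw [Fintype.sum_pow]
  refine Finset.sum_congr rfl fun i _ => ?_
  rw [Finset.prod_mul_distrib, Finset.prod_pow_eq_pow_sum]

lemma periodic_form (N : ℕ) (v : ℕ → ℝ) (hac : ∀ i, i + 4 ≤ N → v (i + 4) = v i) (k : ℕ) :
    k ≤ N → v k = (v 0 + v 1 + v 2 + v 3) / 4 + (v 0 - v 1 + v 2 - v 3) / 4 * (-1) ^ k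
      + (v 0 - v 2) / 2 * (Complex.I ^ k).re + (v 1 - v 3) / 2 * (Complex.I ^ k).im := by
  induction k using Nat.strong_induction_on with
  | _ k ih =>
    intro hk
    match k, ih, hk with
    | 0, _, _ => simp; ring
    | 1, _, _ => simp; ring
    | 2, _, _ => simp; ring
    | 3, _, _ => simp [Complex.I_pow_three]; ring
    | k + 4, ih, hk =>
      rw [hac k hk, ih k (by omega) (by omega), pow_add, pow_add, Complex.I_pow_four]
      norm_num

lemma hankel_form (n : ℕ) (v : ℕ → ℝ)
    (hac : ∀ i, i + 4 ≤ (n - 1) * 4 → v (i + 4) = v i) (x : Fin n → ℝ) :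
    hankelPoly 4 n v x = (v 0 + v 1 + v 2 + v 3) / 4 * (∑ i, x i) ^ 4
      + (v 0 - v 1 + v 2 - v 3) / 4 * (∑ i : Fin n, (-1 : ℝ) ^ (i : ℕ) * x i) ^ 4
      + (v 0 - v 2) / 2 * ((∑ i : Fin n, Complex.I ^ (i : ℕ) * (x i : ℂ)) ^ 4).re
      + (v 1 - v 3) / 2 * ((∑ i : Fin n, Complex.I ^ (i : ℕ) * (x i : ℂ)) ^ 4).im := by
  have h1 := hankel_geom 4 n (1 : ℝ) x
  simp only [one_pow, one_mul] at h1
  rw [← h1, ← hankel_geom, ← hankel_geom, Complex.re_sum, Complex.im_sum, Finset.mul_sum,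
    Finset.mul_sum, Finset.mul_sum, Finset.mul_sum, ← Finset.sum_add_distrib,
    ← Finset.sum_add_distrib, ← Finset.sum_add_distrib, hankelPoly]
  refine Finset.sum_congr rfl fun i _ => ?_
  have hle : ∑ j, (i j : ℕ) ≤ (n - 1) * 4 := by
    rw [Fin.sum_univ_four]
    have h := fun j => (i j).isLt
    have := h 0; have := h 1; have := h 2; have := h 3
    omega
  rw [periodic_form _ v hac _ hle, ← Complex.ofReal_prod, Complex.re_mul_ofReal,
    Complex.im_mul_ofReal]
  ring

/-- A test vector supported on the first four coordinates. -/
noncomputable def testVec (p q r s : ℝ) : ℕ → ℝ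
  | 0 => p
  | 1 => q
  | 2 => r
  | 3 => s
  | _ => 0

lemma sum_testVec {R : Type*} [CommSemiring R] (φ : ℝ →+* R) (n : ℕ) (hn : 4 ≤ n) (z : R)
    (p q r s : ℝ) :
    ∑ i : Fin n, z ^ (i : ℕ) * φ (testVec p q r s i)
      = φ p + z * φ q + z ^ 2 * φ r + z ^ 3 * φ s := by
  obtain ⟨m, rfl⟩ := Nat.exists_eq_add_of_le' hn
  rw [Fin.sum_univ_eq_sum_range (fun k => z ^ k * φ (testVec p q r s k)), add_comm m,
    Finset.sum_range_add, Finset.sum_eq_zero (s := Finset.range m)]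
  · simp [Finset.sum_range_succ, testVec]
  · intro k _
    rw [add_comm 4 k]
    simp [testVec]

lemma hankel_test (n : ℕ) (hn : 4 ≤ n) (v : ℕ → ℝ)
    (hac : ∀ i, i + 4 ≤ (n - 1) * 4 → v (i + 4) = v i) (p q r s : ℝ) :
    hankelPoly 4 n v (fun i => testVec p q r s i) =
      (v 0 + v 1 + v 2 + v 3) / 4 * (p + q + r + s) ^ 4
      + (v 0 - v 1 + v 2 - v 3) / 4 * (p - q + r - s) ^ 4
      + (v 0 - v 2) / 2 * ((p - r) ^ 4 - 6 * (p - r) ^ 2 * (q - s) ^ 2 + (q - s) ^ 4)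
      + (v 1 - v 3) / 2 * (4 * (p - r) ^ 3 * (q - s) - 4 * (p - r) * (q - s) ^ 3) := by
  rw [hankel_form n v hac]
  have h1 := sum_testVec (RingHom.id ℝ) n hn 1 p q r s
  have h2 := sum_testVec (RingHom.id ℝ) n hn (-1) p q r s
  have h3 := sum_testVec Complex.ofRealHom n hn Complex.I p q r s
  simp only [one_pow, one_mul, RingHom.id_apply, Complex.ofRealHom_eq_coe] at h1 h2 h3
  rw [h1, h2, h3]
  have h4 : ((p : ℂ) + Complex.I * q + Complex.I ^ 2 * r + Complex.I ^ 3 * s) ^ 4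
      = (((p - r) ^ 4 - 6 * (p - r) ^ 2 * (q - s) ^ 2 + (q - s) ^ 4 : ℝ) : ℂ)
        + ((4 * (p - r) ^ 3 * (q - s) - 4 * (p - r) * (q - s) ^ 3 : ℝ) : ℂ) * Complex.I := by
    have e : ((p : ℂ) + Complex.I * q + Complex.I ^ 2 * r + Complex.I ^ 3 * s)
      = (p - r) + (q - s) * Complex.I := by
      rw [Complex.I_pow_three, Complex.I_sq]; ring
    rw [e]
    push_cast
    have hI := Complex.I_sq
    generalize (p : ℂ) - r = a
    generalize (q : ℂ) - s = b
    linear_combination (6 * a ^ 2 * b ^ 2 + 4 * a * b ^ 3 * Complex.I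
      + b ^ 4 * (Complex.I ^ 2 - 1)) * hI
  rw [h4]
  simp only [Complex.add_re, Complex.add_im, Complex.re_ofReal_mul, Complex.im_ofReal_mul,
    Complex.ofReal_re, Complex.ofReal_im, Complex.I_re, Complex.I_im]
  ring

/-- Fourth order generalized anti-circulant tensors with circulant index 4 and `n ≥ 4`:
the tensor is PSD iff `v₀ = v₂`, `v₁ = v₃` and `|v₁| ≤ v₀`; in this case, writing
`v₁ = v₀ (2t − 1)` with `t ∈ [0,1]`, the Hankel polynomial is
`t v₀ (x₁ + ⋯ + x_n)⁴ + (1 − t) v₀ (x₁ − x₂ + ⋯ + (−1)^{n−1} x_n)⁴`, and the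
associated `(2n−1)×(2n−1)` Hankel matrix is positive semidefinite (strong Hankel tensor). -/
theorem anticirculant_fourth_order_index_four (n : ℕ) (hn : 4 ≤ n) (v : ℕ → ℝ)
    (hac : ∀ i, i + 4 ≤ (n - 1) * 4 → v (i + 4) = v i) :
    ((∀ x : Fin n → ℝ, 0 ≤ hankelPoly 4 n v x) ↔
      (v 0 = v 2 ∧ v 1 = v 3 ∧ |v 1| ≤ v 0)) ∧
    ((v 0 = v 2 ∧ v 1 = v 3 ∧ |v 1| ≤ v 0) →
      ∀ t : ℝ, t ∈ Set.Icc (0 : ℝ) 1 → v 1 = v 0 * (2 * t - 1) →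
        (∀ x : Fin n → ℝ, hankelPoly 4 n v x =
          t * v 0 * (∑ i, x i) ^ 4 + (1 - t) * v 0 * (∑ i : Fin n, (-1 : ℝ) ^ (i : ℕ) * x i) ^ 4) ∧
        (hankelMatrix (2 * n - 1) v).PosSemidef) := by
  have key : (v 0 = v 2 ∧ v 1 = v 3 ∧ |v 1| ≤ v 0) → ∀ x : Fin n → ℝ, hankelPoly 4 n v x =
      (v 0 + v 1) / 2 * (∑ i, x i) ^ 4
      + (v 0 - v 1) / 2 * (∑ i : Fin n, (-1 : ℝ) ^ (i : ℕ) * x i) ^ 4 := by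
    rintro ⟨h0, h1, -⟩ x
    rw [hankel_form n v hac, ← h0, ← h1]
    ring
  refine ⟨⟨fun h => ?_, fun h x => ?_⟩, fun h t ht hv => ⟨fun x => ?_, ?_⟩⟩
  · have T := fun p q r s => (hankel_test n hn v hac p q r s) ▸ h _
    have a1 := T 1 0 (-1) 0
    have a2 := T 1 1 (-1) (-1)
    have a3 := T 2 1 (-2) (-1)
    have a4 := T 1 2 (-1) (-2)
    have a5 := T 1 1 1 1
    have a6 := T 1 (-1) 1 (-1)
    norm_num at a1 a2 a3 a4 a5 a6
    have e0 : v 0 = v 2 := by linarith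
    have e1 : v 1 = v 3 := by linarith
    exact ⟨e0, e1, abs_le.2 ⟨by linarith, by linarith⟩⟩
  · rw [key h]
    obtain ⟨hl, hr⟩ := abs_le.1 h.2.2
    have : 0 ≤ (v 0 + v 1) / 2 := by linarith
    have : 0 ≤ (v 0 - v 1) / 2 := by linarith
    positivity
  · rw [key h, hv]
    ring
  · have hv0 : 0 ≤ v 0 := (abs_nonneg _).trans h.2.2
    have e : hankelMatrix (2 * n - 1) v
        = (t * v 0) • Matrix.vecMulVec (fun _ => (1 : ℝ)) (star fun _ => (1 : ℝ))
        + ((1 - t) * v 0) • Matrix.vecMulVec (fun i : Fin (2 * n - 1) => (-1 : ℝ) ^ (i : ℕ))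
            (star fun i : Fin (2 * n - 1) => (-1 : ℝ) ^ (i : ℕ)) := by
      ext i j
      have hi := i.isLt
      have hj := j.isLt
      have := periodic_form _ v hac (i + j) (by omega)
      rw [← h.1, ← h.2.1, hv] at this
      simp only [hankelMatrix, Matrix.of_apply, Matrix.add_apply, Matrix.smul_apply,
        Matrix.vecMulVec_apply, Pi.star_apply, star_trivial, smul_eq_mul]
      rw [this, pow_add]
      ring
    rw [e]
    exact ((Matrix.posSemidef_vecMulVec_self_star _).smul (mul_nonneg ht.1 hv0)).add
      ((Matrix.posSemidef_vecMulVec_self_star _).smul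
        (mul_nonneg (sub_nonneg.2 ht.2) hv0))
end
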